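/- Assume F contains an element i with i² = −1. Then the map Φ* : Der(J)^{[0,0]} → Der(K) defined by Φ*(∂)(z) = Φ⁻¹([∂, Φ(z)]) (supercommutator in End_F(J)) is an injective homomorphism of Lie superalgebras whose image is D̄er(K) = Der(K)₀ ⊕ {η_a : a ∈ Z}, and Φ* maps Inder(J)^{[0,0]} onto Inder(K). In particular Der(J)^{[0,0]} ≅ D̄er(K) and Inder(J)^{[0,0]} ≅ Inder(K) as Lie superalgebras. -/

import Mathlib

namespace CKJ

variable (F : Type*) [Field F] {Z : Type*} [CommRing Z] [Algebra F Z]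

/-- Underlying module of the Cheng–Kac Jordan superalgebra `JCK(Z,δ)`:
the even part has `Z`-coordinates `1, w₁, w₂, w₃` (indices `0,1,2,3`) and the
odd part has `Z`-coordinates `x, x₁, x₂, x₃` (indices `0,1,2,3`). -/
abbrev J (Z : Type*) := (Fin 4 → Z) × (Fin 4 → Z)

/-- The product of two even elements, in coordinates:
`w₁² = w₂² = 1`, `w₃² = -1`, `wᵢwⱼ = 0` for `i ≠ j`. -/
def emul (a c : Fin 4 → Z) : Fin 4 → Z :=
  ![a 0 * c 0 + a 1 * c 1 + a 2 * c 2 - a 3 * c 3,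
    a 0 * c 1 + a 1 * c 0,
    a 0 * c 2 + a 2 * c 0,
    a 0 * c 3 + a 3 * c 0]

/-- The product of two odd elements: `(fx)(gx) = δ(f)g - fδ(g)`,
`(fxᵢ)(gx) = (fg)wᵢ`, `(fx)(gxⱼ) = -(fg)wⱼ`, `(fxᵢ)(gxⱼ) = 0`. -/
def omul (δ : Z → Z) (b d : Fin 4 → Z) : Fin 4 → Z :=
  ![δ (b 0) * d 0 - b 0 * δ (d 0),
    b 1 * d 0 - b 0 * d 1,
    b 2 * d 0 - b 0 * d 2,
    b 3 * d 0 - b 0 * d 3]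

/-- The product of an even element by an odd element: `f(gx) = (fg)x`,
`f(gxⱼ) = (fg)xⱼ`, `(fwᵢ)(gx) = (δ(f)g)xᵢ`, `(fwᵢ)(gxⱼ) = -(fg)x_{i×j}`. -/
def eomul (δ : Z → Z) (a d : Fin 4 → Z) : Fin 4 → Z :=
  ![a 0 * d 0,
    a 0 * d 1 + δ (a 1) * d 0 + (a 2 * d 3 - a 3 * d 2),
    a 0 * d 2 + δ (a 2) * d 0 + (a 3 * d 1 - a 1 * d 3),
    a 0 * d 3 + δ (a 3) * d 0 + (a 2 * d 1 - a 1 * d 2)]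

/-- The (supercommutative) multiplication of the Cheng–Kac Jordan
superalgebra `JCK(Z,δ)`. -/
def jmul (δ : Z → Z) (u v : J Z) : J Z :=
  (emul u.1 v.1 + omul δ u.2 v.2, eomul δ u.1 v.2 + eomul δ v.1 u.2)

/-- `fw f k` is the even element `f·wₖ` (with the convention `w₀ = 1`). -/
def fw (f : Z) (k : Fin 4) : J Z := (fun j => if j = k then f else 0, 0)

/-- `fone f` is the even element `f·1`. -/
def fone (f : Z) : J Z := fw f 0

/-- `fxi f k` is the odd element `f·xₖ` (with the convention `x₀ = x`). -/
def fxi (f : Z) (k : Fin 4) : J Z := (0, fun j => if j = k then f else 0)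

/-- `fx f` is the odd element `f·x`. -/
def fx (f : Z) : J Z := fxi f 0

/-- The grading involution of the superalgebra `J` (identity on the even part,
minus the identity on the odd part). -/
def jsig (u : J Z) : J Z := (u.1, -u.2)

/-- `F`-linearity of a map `J → J`. -/
def IsLin (d : J Z → J Z) : Prop :=
  (∀ u v, d (u + v) = d u + d v) ∧ ∀ (c : F) (u), d (c • u) = c • d u

/-- `d` is an even derivation of the superalgebra `J = JCK(Z,δ)`. -/
def IsDer0 (δ : Z → Z) (d : J Z → J Z) : Prop :=
  IsLin F d ∧ (∀ u : J Z, u.2 = 0 → (d u).2 = 0) ∧ (∀ u : J Z, u.1 = 0 → (d u).1 = 0) ∧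
    ∀ u v, d (jmul δ u v) = jmul δ (d u) v + jmul δ u (d v)

/-- `d` is an odd derivation of the superalgebra `J = JCK(Z,δ)`. -/
def IsDer1 (δ : Z → Z) (d : J Z → J Z) : Prop :=
  IsLin F d ∧ (∀ u : J Z, u.2 = 0 → (d u).1 = 0) ∧ (∀ u : J Z, u.1 = 0 → (d u).2 = 0) ∧
    ∀ u v, d (jmul δ u v) = jmul δ (d u) v + jmul δ (jsig u) (d v)

/-- The set `Der(J) = Der(J)₀ ⊕ Der(J)₁` of all derivations of `J`. -/
def DerJSet (δ : Z → Z) : Set (J Z → J Z) :=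
  {d | ∃ d0 d1, IsDer0 F δ d0 ∧ IsDer1 F δ d1 ∧ d = d0 + d1}

/-- `u` is homogeneous of parity `p` (`p = true` means odd). -/
def IsHom (p : Bool) (u : J Z) : Prop := if p then u.1 = 0 else u.2 = 0

/-- `(-1)^{pq}` -/
def sgn (p q : Bool) : ℤ := if p && q then -1 else 1

/-- `Dgen δ ε u v` is the inner derivation `D(u,v) : c ↦ u(vc) - ε·v(uc)`;
for homogeneous `u`, `v` one takes `ε = (-1)^{|u||v|}`. -/
def Dgen (δ : Z → Z) (ε : ℤ) (u v : J Z) : J Z → J Z :=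
  fun c => jmul δ u (jmul δ v c) - ε • jmul δ v (jmul δ u c)

/-- Generators `D(u,v)`, `u`, `v` homogeneous, of `Inder(J)`. -/
def InderSet (δ : Z → Z) : Set (J Z → J Z) :=
  {d | ∃ u v p q, IsHom p u ∧ IsHom q v ∧ d = Dgen δ (sgn p q) u v}

/-- Generators of the even part `Inder(J)₀`. -/
def InderSet0 (δ : Z → Z) : Set (J Z → J Z) :=
  {d | ∃ u v p, IsHom p u ∧ IsHom p v ∧ d = Dgen δ (sgn p p) u v}

/-- Generators of the odd part `Inder(J)₁`. -/
def InderSet1 (δ : Z → Z) : Set (J Z → J Z) :=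
  {d | ∃ u v p, IsHom p u ∧ IsHom (!p) v ∧ d = Dgen δ 1 u v}

/-- Coordinate index of each sector of the `ℤ₂×ℤ₂`-grading:
`[0,0] ↦ 0`, `[1,0] ↦ 1`, `[0,1] ↦ 2`, `[1,1] ↦ 3`. -/
def idx (t : ZMod 2 × ZMod 2) : Fin 4 :=
  if t = (0, 0) then 0 else if t = (1, 0) then 1 else if t = (0, 1) then 2 else 3

/-- The sector `J^{[t]}` of the `ℤ₂×ℤ₂`-grading of `J`:
`J^{[0,0]} = Z ⊕ Zx`, `J^{[1,0]} = Zw₁ ⊕ Zx₁`, `J^{[0,1]} = Zw₂ ⊕ Zx₂`,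
`J^{[1,1]} = Zw₃ ⊕ Zx₃`. -/
def gset (t : ZMod 2 × ZMod 2) : Set (J Z) :=
  {u | ∀ k : Fin 4, k ≠ idx t → u.1 k = 0 ∧ u.2 k = 0}

/-- `d : J → J` has degree `t` with respect to the `ℤ₂×ℤ₂`-grading of `J`. -/
def DerDeg (t : ZMod 2 × ZMod 2) (d : J Z → J Z) : Prop :=
  ∀ s u, u ∈ gset s → d u ∈ gset (s + t)

/-! The Kantor double superalgebra of vector type `K = Z ⊕ Zx`, realised
as `Z × Z`: the pair `(f, g)` represents `f + gx`. -/

/-- The multiplication of `K = Z ⊕ Zx`. -/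
def kmul (δ : Z → Z) (u v : Z × Z) : Z × Z :=
  (u.1 * v.1 + (δ u.2 * v.2 - u.2 * δ v.2), u.1 * v.2 + v.1 * u.2)

/-- The grading involution of `K`. -/
def ksig (u : Z × Z) : Z × Z := (u.1, -u.2)

/-- `F`-linearity of a map `K → K`. -/
def IsKLin (d : Z × Z → Z × Z) : Prop :=
  (∀ u v, d (u + v) = d u + d v) ∧ ∀ (c : F) (u), d (c • u) = c • d u

/-- `d` is an even derivation of `K = Z ⊕ Zx`. -/
def IsKDer0 (δ : Z → Z) (d : Z × Z → Z × Z) : Prop :=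
  IsKLin F d ∧ (∀ u : Z × Z, u.2 = 0 → (d u).2 = 0) ∧ (∀ u : Z × Z, u.1 = 0 → (d u).1 = 0) ∧
    ∀ u v, d (kmul δ u v) = kmul δ (d u) v + kmul δ u (d v)

/-- `d` is an odd derivation of `K = Z ⊕ Zx`. -/
def IsKDer1 (δ : Z → Z) (d : Z × Z → Z × Z) : Prop :=
  IsKLin F d ∧ (∀ u : Z × Z, u.2 = 0 → (d u).1 = 0) ∧ (∀ u : Z × Z, u.1 = 0 → (d u).2 = 0) ∧
    ∀ u v, d (kmul δ u v) = kmul δ (d u) v + kmul δ (ksig u) (d v)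

/-- `Dk δ ε u v` is the inner derivation `D(u,v) : c ↦ u(vc) - ε·v(uc)` of `K`. -/
def Dk (δ : Z → Z) (ε : ℤ) (u v : Z × Z) : Z × Z → Z × Z :=
  fun c => kmul δ u (kmul δ v c) - ε • kmul δ v (kmul δ u c)

/-- `u ∈ K` is homogeneous of parity `p`. -/
def KHom (p : Bool) (u : Z × Z) : Prop := if p then u.1 = 0 else u.2 = 0

/-- Generators `D(u,v)`, `u`, `v` homogeneous, of `Inder(K)`. -/
def InderKSet (δ : Z → Z) : Set (Z × Z → Z × Z) :=
  {d | ∃ u v p q, KHom p u ∧ KHom q v ∧ d = Dk δ (sgn p q) u v}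

/-- Generators of the even part `Inder(K)₀`. -/
def InderKSet0 (δ : Z → Z) : Set (Z × Z → Z × Z) :=
  {d | ∃ u v p, KHom p u ∧ KHom p v ∧ d = Dk δ (sgn p p) u v}

/-- Generators of the odd part `Inder(K)₁`. -/
def InderKSet1 (δ : Z → Z) : Set (Z × Z → Z × Z) :=
  {d | ∃ u v p, KHom p u ∧ KHom (!p) v ∧ d = Dk δ 1 u v}

/-- The odd derivation `η_a` of `K`: `η_a(f) = 0`, `η_a(fx) = fa`. -/
def keta (a : Z) : Z × Z → Z × Z := fun u => (a * u.2, 0)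

/-- `kcheck μ a` is the even map `μ̌` of `K` with `μ̌(f) = μ(f)` and
`μ̌(gx) = (μ(g) + ag)x`. -/
def kcheck (μ : Z → Z) (a : Z) : Z × Z → Z × Z := fun u => (μ u.1, μ u.2 + a * u.2)

/-- The odd map `(aδ)⁻` of `K` (relevant in characteristic 3):
`(aδ)⁻(f) = (aδ(f))x`, `(aδ)⁻(fx) = δ(aδ(f))`. -/
def kminus (δ : Z → Z) (a : Z) : Z × Z → Z × Z := fun u => (δ (a * δ u.2), a * δ u.1)

/-- `D̄er(K) = Der(K)₀ ⊕ {η_a : a ∈ Z}`. -/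
def DerbarK (δ : Z → Z) : Set (Z × Z → Z × Z) :=
  {e | ∃ e0 a, IsKDer0 F δ e0 ∧ e = e0 + keta a}

/-- The extension `∂̃` to `J` of the even derivation `∂ = μ̌ = kcheck μ a`
of `K`: `∂̃|_K = ∂`, `∂̃(fwᵢ) = μ(f)wᵢ`, `∂̃(fxᵢ) = (μ(f) - af)xᵢ`. -/
def jtilde (μ : Z → Z) (a : Z) : J Z → J Z :=
  fun u => (fun k => μ (u.1 k),
    fun k => if k = 0 then μ (u.2 0) + a * u.2 0 else μ (u.2 k) - a * u.2 k)

/-- The odd derivation `η̃_a` of `J`: `η̃_a(Z) = 0`, `η̃_a(x) = a`,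
`η̃_a(xⱼ) = 0` (hence `η̃_a(fwᵢ) = -(af)xᵢ`). -/
def jeta (a : Z) : J Z → J Z :=
  fun u => (fun k => if k = 0 then a * u.2 0 else 0,
            fun k => if k = 0 then 0 else -(a * u.1 k))

/-- The even component of an endomorphism of `J`. -/
def evp (X : J Z → J Z) : J Z → J Z := fun u => (2 : F)⁻¹ • (X u + jsig (X (jsig u)))

/-- The odd component of an endomorphism of `J`. -/
def odp (X : J Z → J Z) : J Z → J Z := fun u => (2 : F)⁻¹ • (X u - jsig (X (jsig u)))

/-- The supercommutator `[X,Y]` in `End_F(J)`. -/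
def sbr (X Y : J Z → J Z) : J Z → J Z :=
  X ∘ Y - Y ∘ X + (2 : F) • (odp F Y ∘ odp F X)

/-- The odd component of an endomorphism of `K`. -/
def kodp (e : Z × Z → Z × Z) : Z × Z → Z × Z :=
  fun u => (2 : F)⁻¹ • (e u - ksig (e (ksig u)))

/-- The supercommutator `[e,e']` in `End_F(K)`. -/
def ksbr (e e' : Z × Z → Z × Z) : Z × Z → Z × Z :=
  e ∘ e' - e' ∘ e + (2 : F) • (kodp F e' ∘ kodp F e)

/-- The automorphism `τ₁ = (12)(34)`: identity on `J^{[0,0]} ⊕ J^{[1,1]}`,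
`-1` on `J^{[1,0]} ⊕ J^{[0,1]}`. -/
def tau1Map : J Z → J Z :=
  fun u => (![u.1 0, -u.1 1, -u.1 2, u.1 3], ![u.2 0, -u.2 1, -u.2 2, u.2 3])

/-- The automorphism `τ₂ = (23)(41)`: identity on `J^{[0,0]} ⊕ J^{[1,0]}`,
`-1` on `J^{[0,1]} ⊕ J^{[1,1]}`. -/
def tau2Map : J Z → J Z :=
  fun u => (![u.1 0, u.1 1, -u.1 2, -u.1 3], ![u.2 0, u.2 1, -u.2 2, -u.2 3])

/-- The automorphism `φ = (123)`: the `Z`-linear map with `φ(vⱼ) = vⱼ₊₁`,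
`φ(yⱼ) = yⱼ₊₁` (indices mod 3), `φ(1) = 1`, `φ(y) = y`, where `v₁ = i·w₁`,
`v₂ = i·w₂`, `v₃ = w₃`, `y = x`, `y₁ = i·x₁`, `y₂ = i·x₂`, `y₃ = x₃`.
In the `w`/`x` coordinates: `w₁ ↦ w₂ ↦ -i·w₃`, `w₃ ↦ i·w₁`,
`x₁ ↦ x₂ ↦ -i·x₃`, `x₃ ↦ i·x₁`. -/
def phiMap (i : F) : J Z → J Z :=
  fun u => (![u.1 0, algebraMap F Z i * u.1 3, u.1 1, -(algebraMap F Z i * u.1 2)],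
            ![u.2 0, algebraMap F Z i * u.2 3, u.2 1, -(algebraMap F Z i * u.2 2)])

/-- The automorphism `τ = (12)`: `Z`-linear with `τ(1) = 1`, `τ(y) = y`,
`τ(v₁) = -v₂`, `τ(v₂) = -v₁`, `τ(v₃) = -v₃`, `τ(y₁) = -y₂`, `τ(y₂) = -y₁`,
`τ(y₃) = -y₃`. -/
def tauMap : J Z → J Z :=
  fun u => (![u.1 0, -u.1 2, -u.1 1, -u.1 3], ![u.2 0, -u.2 2, -u.2 1, -u.2 3])

/-- `g` is an `F`-algebra automorphism of `J = JCK(Z,δ)`. -/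
def IsJAut (δ : Z → Z) (g : J Z → J Z) : Prop :=
  IsLin F g ∧ Function.Bijective g ∧ ∀ u v, g (jmul δ u v) = jmul δ (g u) (g v)

/-- The coordinatization map `Φ : K → Der(J)^{[1,1]}`,
`Φ(f + gy) = D(v₁, f·v₂) + i·D(v₃, g·y)`. -/
def Phi (δ : Z → Z) (i : F) (p : Z × Z) : J Z → J Z :=
  Dgen δ 1 (fw (algebraMap F Z i) 1) (fw (p.1 * algebraMap F Z i) 2) +
    i • Dgen δ 1 (fw (1 : Z) 3) (fx p.2)

/-- `ι₁(z) = φ ∘ Φ(z) ∘ φ⁻¹`, `ι₂(z) = φ² ∘ Φ(z) ∘ φ⁻²`, `ι₃(z) = Φ(z)`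
(indexed here by `j = 0, 1, 2` respectively; note `φ⁻¹ = φ²`). -/
def iot (δ : Z → Z) (i : F) (j : Fin 3) (z : Z × Z) : J Z → J Z :=
  if j = 0 then phiMap F i ∘ Phi F δ i z ∘ (phiMap F i ∘ phiMap F i)
  else if j = 1 then (phiMap F i ∘ phiMap F i) ∘ Phi F δ i z ∘ phiMap F i
  else Phi F δ i z

/-- The embedding `K = Z ⊕ Zx ⊆ J`. -/
def kap : Z × Z → J Z :=
  fun p => (fun j => if j = 0 then p.1 else 0, fun j => if j = 0 then p.2 else 0)

/-- The projection `J → K` onto the `Z ⊕ Zx` coordinates. -/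
def pik : J Z → Z × Z := fun u => (u.1 0, u.2 0)

end CKJ

namespace CKJ

section Products

variable {F : Type*} [Field F] {Z : Type*} [CommRing Z] [Algebra F Z] (δ : Derivation F Z Z)

lemma jmul_fw_zero_fw (f g : Z) (k : Fin 4) : jmul δ (fw f 0) (fw g k) = fw (f * g) k := by
  ext j <;> fin_cases k <;> fin_cases j <;> simp [jmul, emul, omul, eomul, fw]

lemma jmul_fw_zero_fxi (f g : Z) (k : Fin 4) : jmul δ (fw f 0) (fxi g k) = fxi (f * g) k := by
  ext j <;> fin_cases k <;> fin_cases j <;> simp [jmul, emul, omul, eomul, fw, fxi]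

lemma jmul_fw_fxi_zero (f g : Z) {k : Fin 4} (hk : k ≠ 0) :
    jmul δ (fw f k) (fxi g 0) = fxi (δ f * g) k := by
  ext j <;> fin_cases k <;> fin_cases j <;> simp_all [jmul, emul, omul, eomul, fw, fxi]

lemma jmul_fxi_fxi_zero (f g : Z) {k : Fin 4} (hk : k ≠ 0) :
    jmul δ (fxi f k) (fxi g 0) = fw (f * g) k := by
  ext j <;> fin_cases k <;> fin_cases j <;> simp_all [jmul, emul, omul, eomul, fw, fxi]

lemma jmul_fxi_zero_fxi_zero (f g : Z) :
    jmul δ (fxi f 0) (fxi g 0) = fw (δ f * g - f * δ g) 0 := by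
  ext j <;> fin_cases j <;> simp [jmul, emul, omul, eomul, fw, fxi]

lemma jmul_fxi_zero_fxi (f g : Z) {k : Fin 4} (hk : k ≠ 0) :
    jmul δ (fxi f 0) (fxi g k) = fw (-(f * g)) k := by
  ext j <;> fin_cases k <;> fin_cases j <;> simp_all [jmul, emul, omul, eomul, fw, fxi]

lemma jmul_fw_one_sq {k : Fin 4} (hk : k ≠ 0) :
    jmul δ (fw 1 k) (fw 1 k) = fw 1 0 ∨ jmul δ (fw 1 k) (fw 1 k) = -fw 1 0 := by
  by_cases h3 : k = 3
  · right
    subst h3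
    ext j <;> fin_cases j <;> simp [jmul, emul, omul, eomul, fw]
  · left
    ext j <;> fin_cases k <;> fin_cases j <;> simp_all [jmul, emul, omul, eomul, fw]

lemma jmul_fxi_fxi_of_ne_zero (f g : Z) {j k : Fin 4} (hj : j ≠ 0) (hk : k ≠ 0) :
    jmul δ (fxi f j) (fxi g k) = 0 := by
  ext l <;> fin_cases l <;> simp [jmul, emul, omul, eomul, fxi, hj.symm, hk.symm]

lemma jmul_fw_fw_of_ne (f g : Z) {j k : Fin 4} (hj : j ≠ 0) (hk : k ≠ 0) (hjk : j ≠ k) :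
    jmul δ (fw f j) (fw g k) = 0 := by
  ext l <;> fin_cases j <;> fin_cases k <;> fin_cases l <;>
    simp_all [jmul, emul, omul, eomul, fw]

lemma exists_jmul_fw_fxi_eq {k : Fin 4} (hk : k ≠ 0) :
    ∃ i j : Fin 4, i ≠ 0 ∧ j ≠ 0 ∧ i ≠ j ∧ jmul δ (fw 1 i) (fxi 1 j) = -fxi 1 k := by
  fin_cases k
  · simp at hk
  · refine ⟨3, 2, by decide, by decide, by decide, ?_⟩
    ext l <;> fin_cases l <;> simp [jmul, emul, omul, eomul, fw, fxi]
  · refine ⟨1, 3, by decide, by decide, by decide, ?_⟩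
    ext l <;> fin_cases l <;> simp [jmul, emul, omul, eomul, fw, fxi]
  · refine ⟨1, 2, by decide, by decide, by decide, ?_⟩
    ext l <;> fin_cases l <;> simp [jmul, emul, omul, eomul, fw, fxi]

lemma jmul_comm_fw_fxi (f g : Z) (j k : Fin 4) :
    jmul δ (fxi f j) (fw g k) = jmul δ (fw g k) (fxi f j) := by
  ext l <;> fin_cases l <;> simp [jmul, emul, omul, eomul, fw, fxi]

lemma jmul_comm_fw_fw (f g : Z) (j k : Fin 4) :
    jmul δ (fw f j) (fw g k) = jmul δ (fw g k) (fw f j) := by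
  suffices h : ∀ a c : Fin 4 → Z, jmul δ (a, 0) (c, 0) = jmul δ (c, 0) (a, 0) from h _ _
  intro a c
  ext l <;> fin_cases l <;> simp [jmul, emul, omul, eomul] <;> ring

lemma eq_sum_basis (u : J Z) :
    u = ∑ k, (fw (u.1 k) k + fxi (u.2 k) k) := by
  ext j <;> fin_cases j <;> simp [Fin.sum_univ_four, fw, fxi]

end Products

section Degree

variable {F : Type*} [Field F] {Z : Type*} [CommRing Z] [Algebra F Z] (δ : Derivation F Z Z)

lemma exists_idx_eq (k : Fin 4) : ∃ s, idx s = k := by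
  fin_cases k
  · exact ⟨(0, 0), by decide⟩
  · exact ⟨(1, 0), by decide⟩
  · exact ⟨(0, 1), by decide⟩
  · exact ⟨(1, 1), by decide⟩

lemma derDeg_zero_iff {d : J Z → J Z} :
    DerDeg ((0, 0) : ZMod 2 × ZMod 2) d ↔
      ∀ (k : Fin 4) (u : J Z), (∀ j ≠ k, u.1 j = 0 ∧ u.2 j = 0) →
        ∀ j ≠ k, (d u).1 j = 0 ∧ (d u).2 j = 0 := by
  have h0 : ((0, 0) : ZMod 2 × ZMod 2) = 0 := rfl
  constructor
  · intro h k
    obtain ⟨s, rfl⟩ := exists_idx_eq k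
    intro u hu
    have := h s u hu
    rwa [h0, add_zero] at this
  · intro h s u hu
    rw [h0, add_zero]
    exact h (idx s) u hu

variable {δ}

lemma DerDeg.components {d0 d1 : J Z → J Z} (h0 : IsDer0 F δ d0) (h1 : IsDer1 F δ d1)
    (h : DerDeg ((0, 0) : ZMod 2 × ZMod 2) (d0 + d1)) :
    (∀ f k, d0 (fw f k) = fw ((d0 (fw f k)).1 k) k) ∧
    (∀ f k, d0 (fxi f k) = fxi ((d0 (fxi f k)).2 k) k) ∧
    (∀ f k, d1 (fw f k) = fxi ((d1 (fw f k)).2 k) k) ∧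
    (∀ f k, d1 (fxi f k) = fw ((d1 (fxi f k)).1 k) k) := by
  rw [derDeg_zero_iff] at h
  have hw (f : Z) (k : Fin 4) := h k (fw f k) (by intro j hj; simp [fw, hj])
  have hx (f : Z) (k : Fin 4) := h k (fxi f k) (by intro j hj; simp [fxi, hj])
  have e0 (f : Z) (k : Fin 4) : (d0 (fw f k)).2 = 0 := h0.2.1 _ rfl
  have e1 (f : Z) (k : Fin 4) : (d1 (fw f k)).1 = 0 := h1.2.1 _ rfl
  have o0 (f : Z) (k : Fin 4) : (d0 (fxi f k)).1 = 0 := h0.2.2.1 _ rfl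
  have o1 (f : Z) (k : Fin 4) : (d1 (fxi f k)).2 = 0 := h1.2.2.1 _ rfl
  refine ⟨fun f k => ?_, fun f k => ?_, fun f k => ?_, fun f k => ?_⟩
  · refine Prod.ext (funext fun j => ?_) (e0 f k)
    by_cases hj : j = k
    · simp [fw, hj]
    · have h := (hw f k j hj).1
      rw [Pi.add_apply, Prod.fst_add, e1, add_zero] at h
      rw [h]
      simp [fw, hj]
  · refine Prod.ext (o0 f k) (funext fun j => ?_)
    by_cases hj : j = k
    · simp [fxi, hj]
    · have h := (hx f k j hj).2
      rw [Pi.add_apply, Prod.snd_add, o1, add_zero] at h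
      rw [h]
      simp [fxi, hj]
  · refine Prod.ext (e1 f k) (funext fun j => ?_)
    by_cases hj : j = k
    · simp [fxi, hj]
    · have h := (hw f k j hj).2
      rw [Pi.add_apply, Prod.snd_add, e0, zero_add] at h
      rw [h]
      simp [fxi, hj]
  · refine Prod.ext (funext fun j => ?_) (o1 f k)
    by_cases hj : j = k
    · simp [fw, hj]
    · have h := (hx f k j hj).1
      rw [Pi.add_apply, Prod.fst_add, o0, zero_add] at h
      rw [h]
      simp [fw, hj]

end Degree

section Classification

variable {F : Type*} [Field F] {Z : Type*} [CommRing Z] [Algebra F Z] {δ : Derivation F Z Z}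

lemma IsLin.map_sum_basis {d : J Z → J Z} (hd : IsLin F d) (u : J Z) :
    d u = ∑ k, (d (fw (u.1 k) k) + d (fxi (u.2 k) k)) := by
  let L : J Z →ₗ[F] J Z := ⟨⟨d, hd.1⟩, hd.2⟩
  have : L u = ∑ k, (L (fw (u.1 k) k) + L (fxi (u.2 k) k)) := by
    conv_lhs => rw [eq_sum_basis u]
    simp only [map_sum, map_add]
  exact this

lemma fw_injective (k : Fin 4) : Function.Injective (fun f : Z => fw f k) := fun f g h => by
  simpa [fw] using congrArg (fun u : J Z => u.1 k) h

lemma fxi_injective (k : Fin 4) : Function.Injective (fun f : Z => fxi f k) := fun f g h => by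
  simpa [fxi] using congrArg (fun u : J Z => u.2 k) h

lemma fw_add (f g : Z) (k : Fin 4) : fw (f + g) k = fw f k + fw g k := by
  ext j <;> by_cases hj : j = k <;> simp [fw, hj]

lemma fw_smul (c : F) (f : Z) (k : Fin 4) : fw (c • f) k = c • fw f k := by
  ext j <;> by_cases hj : j = k <;> simp [fw, hj]

lemma fxi_add (f g : Z) (k : Fin 4) : fxi (f + g) k = fxi f k + fxi g k := by
  ext j <;> by_cases hj : j = k <;> simp [fxi, hj]

lemma fxi_smul (c : F) (f : Z) (k : Fin 4) : fxi (c • f) k = c • fxi f k := by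
  ext j <;> by_cases hj : j = k <;> simp [fxi, hj]

lemma fxi_neg (f : Z) (k : Fin 4) : fxi (-f) k = -fxi f k := by
  ext j <;> by_cases hj : j = k <;> simp [fxi, hj]

lemma eq_zero_of_two_mul (h2 : (2 : F) ≠ 0) {z : Z} (h : 2 * z = 0) : z = 0 := by
  have : (2 : F) • z = 0 := by rw [Algebra.smul_def, map_ofNat, h]
  exact (smul_eq_zero_iff_right h2).1 this

/-- Even derivations preserving the four sectors are the maps `jtilde μ a`. -/
lemma IsDer0.eq_jtilde (h2 : (2 : F) ≠ 0) {d : J Z → J Z} (hd : IsDer0 F δ d)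
    (hw : ∀ f k, d (fw f k) = fw ((d (fw f k)).1 k) k)
    (hx : ∀ f k, d (fxi f k) = fxi ((d (fxi f k)).2 k) k) :
    ∃ (μ : Derivation F Z Z) (a : Z), (∀ f, μ (δ f) - δ (μ f) = 2 * a * δ f) ∧
      d = jtilde μ a := by
  obtain ⟨hlin, -, -, hder⟩ := hd
  generalize hM : (fun k f => (d (fw f k)).1 k) = M at hw
  generalize hN : (fun k f => (d (fxi f k)).2 k) = N at hx
  replace hw (f k) : d (fw f k) = fw (M k f) k := by rw [← hM]; exact hw f k
  replace hx (f k) : d (fxi f k) = fxi (N k f) k := by rw [← hN]; exact hx f k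
  clear hM hN
  have Mmul (k f g) : M k (f * g) = M 0 f * g + f * M k g := by
    apply fw_injective k
    simpa only [jmul_fw_zero_fw, hw, ← fw_add] using hder (fw f 0) (fw g k)
  have Nmul (k f g) : N k (f * g) = M 0 f * g + f * N k g := by
    apply fxi_injective k
    simpa only [jmul_fw_zero_fxi, hw, hx, ← fxi_add] using hder (fw f 0) (fxi g k)
  have M01 : M 0 1 = 0 := by simpa using Mmul 0 1 1
  have hadd (f g) : M 0 (f + g) = M 0 f + M 0 g := by
    apply fw_injective 0
    simpa only [← fw_add, hw] using hlin.1 (fw f 0) (fw g 0)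
  have hsmul (c : F) (f) : M 0 (c • f) = c • M 0 f := by
    apply fw_injective 0
    simpa only [← fw_smul, hw] using hlin.2 c (fw f 0)
  have Mk1 (k) (hk : k ≠ 0) : M k 1 = 0 := by
    apply eq_zero_of_two_mul h2
    have h := hder (fw 1 k) (fw 1 k)
    have h' : d (jmul δ (fw 1 k) (fw 1 k)) = 0 := by
      have e : d (fw 1 0) = 0 := by rw [hw, M01]; ext j <;> simp [fw]
      have en : d (-fw 1 0) = 0 := by
        have := hlin.2 (-1) (fw 1 0)
        simpa [e] using this
      rcases jmul_fw_one_sq δ hk with h | h <;> rw [h] <;> assumption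
    rw [h', hw] at h
    have h := congrArg (fun u : J Z => u.1 0) h
    fin_cases k
    · simp at hk
    all_goals
      simp [jmul, emul, omul, eomul, fw] at h ⊢
      grind
  have Mk (k f) : M k f = M 0 f := by
    by_cases hk : k = 0
    · rw [hk]
    · simpa [Mk1 k hk] using Mmul k f 1
  have Nk (k f) : N k f = M 0 f + f * N k 1 := by simpa using Nmul k f 1
  have Nk1 (k) (hk : k ≠ 0) : N k 1 = -N 0 1 := by
    have h := hder (fxi 1 k) (fxi 1 0)
    simp only [jmul_fxi_fxi_zero δ _ _ hk, hx, hw, ← fw_add] at h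
    have h := fw_injective k h
    simp only [mul_one, one_mul, Mk k, M01] at h
    linear_combination -h
  let μ : Derivation F Z Z :=
    { toFun := M 0
      map_add' := hadd
      map_smul' := hsmul
      map_one_eq_zero' := M01
      leibniz' := fun f g => by
        simp only [LinearMap.coe_mk, AddHom.coe_mk, smul_eq_mul, Mmul 0 f g]; ring }
  have hμ (f) : μ f = M 0 f := rfl
  refine ⟨μ, N 0 1, fun f => ?_, ?_⟩
  · have h := hder (fw f 1) (fxi 1 0)
    simp only [jmul_fw_fxi_zero δ _ _ one_ne_zero, hx, hw, ← fxi_add] at h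
    have h := fxi_injective 1 h
    rw [mul_one, Nk 1, Nk1 1 one_ne_zero, Mk 1, mul_one] at h
    simp only [hμ]
    linear_combination h
  · funext u
    rw [hlin.map_sum_basis]
    simp only [hw, hx]
    have m1 := Mk 1
    have m2 := Mk 2
    have m3 := Mk 3
    have n0 := Nk 0
    have n1 (f) : N 1 f = M 0 f - N 0 1 * f := by rw [Nk, Nk1 1 (by decide)]; ring
    have n2 (f) : N 2 f = M 0 f - N 0 1 * f := by rw [Nk, Nk1 2 (by decide)]; ring
    have n3 (f) : N 3 f = M 0 f - N 0 1 * f := by rw [Nk, Nk1 3 (by decide)]; ring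
    ext j <;> fin_cases j <;> simp [Fin.sum_univ_four, jtilde, fw, fxi, hμ, m1, m2, m3, n1, n2, n3]
    rw [n0, mul_comm]

/-- Odd derivations preserving the four sectors are the maps `jeta a`. -/
lemma IsDer1.eq_jeta
    (hspan : Submodule.span F {z : Z | ∃ f g : Z, z = f * δ g} = ⊤)
    {d : J Z → J Z} (hd : IsDer1 F δ d)
    (hw : ∀ f k, d (fw f k) = fxi ((d (fw f k)).2 k) k)
    (hx : ∀ f k, d (fxi f k) = fw ((d (fxi f k)).1 k) k) :
    ∃ a : Z, d = jeta a := by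
  obtain ⟨hlin, -, -, hder⟩ := hd
  generalize hA : (fun k f => (d (fw f k)).2 k) = A at hw
  generalize hB : (fun k f => (d (fxi f k)).1 k) = B at hx
  replace hw (f k) : d (fw f k) = fxi (A k f) k := by rw [← hA]; exact hw f k
  replace hx (f k) : d (fxi f k) = fw (B k f) k := by rw [← hB]; exact hx f k
  clear hA hB
  have sw (f : Z) (k) : jsig (fw f k) = fw f k := by simp [jsig, fw]
  have sx (f : Z) (k) : jsig (fxi f k) = fxi (-f) k := by rw [fxi_neg]; simp [jsig, fxi]
  have zw (k) : fw (0 : Z) k = 0 := by ext j <;> simp [fw]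
  have zx (k) : fxi (0 : Z) k = 0 := by ext j <;> simp [fxi]
  have d0 : d 0 = 0 := by simpa using hlin.2 0 0
  have Amul0 (f g) : A 0 (f * g) = A 0 f * g + f * A 0 g := by
    apply fxi_injective 0
    have h := hder (fw f 0) (fw g 0)
    simp only [sw, jmul_fw_zero_fw, hw, jmul_comm_fw_fxi, jmul_fw_zero_fxi, ← fxi_add] at h
    simpa only [mul_comm g] using h
  have A01 : A 0 1 = 0 := by simpa using Amul0 1 1
  have Ak (k) (hk : k ≠ 0) (f) : A k f = f * A k 1 := by
    apply fxi_injective k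
    have h := hder (fw f 0) (fw 1 k)
    simpa [sw, jmul_fw_zero_fw, hw, jmul_comm_fw_fxi, jmul_fw_zero_fxi, jmul_fw_fxi_zero δ _ _ hk,
      zx] using h
  have Ak1 (k) (hk : k ≠ 0) : A k 1 = -B 0 1 := by
    have h := hder (fw 1 k) (fxi 1 0)
    rw [jmul_fw_fxi_zero δ _ _ hk, δ.map_one_eq_zero, zero_mul, zx, d0, sw, hw, hx,
      jmul_fxi_fxi_zero δ _ _ hk, jmul_comm_fw_fw, jmul_fw_zero_fw, ← fw_add, ← zw k] at h
    have h := fw_injective k h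
    simp only [mul_one] at h
    linear_combination -h
  have B0 (f) : B 0 f = δ (A 0 f) + f * B 0 1 := by
    have h := hder (fw f 0) (fxi 1 0)
    rw [jmul_fw_zero_fxi, sw, hw, hx, hx, jmul_fxi_zero_fxi_zero, jmul_fw_zero_fw, ← fw_add] at h
    simpa using fw_injective 0 h
  have Bk1 (k) (hk : k ≠ 0) : B k 1 = 0 := by
    obtain ⟨i, j, hi, hj, hij, e⟩ := exists_jmul_fw_fxi_eq δ hk
    have h := hder (fw 1 i) (fxi 1 j)
    rw [e, sw, hw, hx, jmul_fxi_fxi_of_ne_zero δ _ _ hi hj, jmul_fw_fw_of_ne δ _ _ hi hj hij,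
      add_zero] at h
    have hn : d (-fxi 1 k) = -d (fxi 1 k) := by simpa using hlin.2 (-1) (fxi 1 k)
    rw [hn, neg_eq_zero, hx, ← zw k] at h
    exact fw_injective k h
  have Bk (k) (hk : k ≠ 0) (f) : B k f = -A 0 f := by
    have h := hder (fw f 0) (fxi 1 k)
    rw [jmul_fw_zero_fxi, sw, hw, hx, hx, jmul_fxi_zero_fxi δ _ _ hk, jmul_fw_zero_fw,
      ← fw_add] at h
    simpa [Bk1 k hk] using fw_injective k h
  have key (f g) : -A 0 (δ f * g) = f * δ (A 0 g) := by
    have h := hder (fw f 1) (fxi g 0)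
    rw [jmul_fw_fxi_zero δ _ _ one_ne_zero, sw, hw, hx, hx, jmul_fxi_fxi_zero δ _ _ one_ne_zero,
      jmul_comm_fw_fw, jmul_fw_zero_fw, ← fw_add] at h
    have h := fw_injective 1 h
    rw [Bk 1 one_ne_zero, Ak 1 one_ne_zero, Ak1 1 one_ne_zero, B0 g] at h
    rw [h]
    ring
  let A0 : Z →ₗ[F] Z :=
    { toFun := A 0
      map_add' := fun f g => by
        apply fxi_injective 0
        simpa only [← fxi_add, ← fw_add, hw] using hlin.1 (fw f 0) (fw g 0)
      map_smul' := fun c f => by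
        apply fxi_injective 0
        simpa only [← fxi_smul, ← fw_smul, hw, RingHom.id_apply] using hlin.2 c (fw f 0) }
  have hA0 : A0 = 0 := by
    refine LinearMap.ext_on hspan ?_
    rintro _ ⟨f, g, rfl⟩
    have h1 := key 1 f
    have h2 := key g f
    rw [δ.map_one_eq_zero, zero_mul, one_mul] at h1
    have e : A 0 0 = 0 := A0.map_zero
    rw [← h1, e, neg_zero, mul_zero, neg_eq_zero, mul_comm] at h2
    exact h2
  have A0z (f) : A 0 f = 0 := congrArg (fun L : Z →ₗ[F] Z => L f) hA0
  have a1 (f) : A 1 f = -(B 0 1 * f) := by rw [Ak 1 (by decide), Ak1 1 (by decide)]; ring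
  have a2 (f) : A 2 f = -(B 0 1 * f) := by rw [Ak 2 (by decide), Ak1 2 (by decide)]; ring
  have a3 (f) : A 3 f = -(B 0 1 * f) := by rw [Ak 3 (by decide), Ak1 3 (by decide)]; ring
  have b0 (f) : B 0 f = B 0 1 * f := by rw [B0, A0z, map_zero]; ring
  have b1 (f) : B 1 f = 0 := by rw [Bk 1 (by decide), A0z, neg_zero]
  have b2 (f) : B 2 f = 0 := by rw [Bk 2 (by decide), A0z, neg_zero]
  have b3 (f) : B 3 f = 0 := by rw [Bk 3 (by decide), A0z, neg_zero]
  refine ⟨B 0 1, funext fun u => ?_⟩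
  rw [hlin.map_sum_basis]
  simp only [hw, hx]
  ext j <;> fin_cases j <;>
    simp [Fin.sum_univ_four, jeta, fw, fxi, A0z, a1, a2, a3, b1, b2, b3]
  rw [b0]

end Classification
end CKJ

namespace CKJ

section Models

variable {F : Type*} [Field F] {Z : Type*} [CommRing Z] [Algebra F Z] {δ : Derivation F Z Z}

lemma isDer0_jtilde {μ : Derivation F Z Z} {a : Z}
    (h : ∀ f, μ (δ f) - δ (μ f) = 2 * a * δ f) : IsDer0 F δ (jtilde μ a) := by
  have h' (f : Z) : μ (δ f) = δ (μ f) + 2 * a * δ f := by rw [← h]; ring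
  refine ⟨⟨fun u v => ?_, fun c u => ?_⟩, fun u hu => ?_, fun u hu => ?_, fun u v => ?_⟩
  · ext j <;> simp [jtilde]
    split_ifs <;> ring
  · ext j <;> simp [jtilde, smul_add, smul_sub]
  · ext j
    simp [jtilde, hu]
  · ext j
    simp [jtilde, hu]
  · ext j <;> fin_cases j <;> simp [jtilde, jmul, emul, omul, eomul, h'] <;> ring

lemma isDer1_jeta (a : Z) : IsDer1 F δ (jeta a) := by
  refine ⟨⟨fun u v => ?_, fun c u => ?_⟩, fun u hu => ?_, fun u hu => ?_, fun u v => ?_⟩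
  · ext j <;> simp [jeta] <;> split_ifs <;> ring
  · ext j <;> simp [jeta]
  · ext j
    simp [jeta, hu]
  · ext j
    simp [jeta, hu]
  · ext j <;> fin_cases j <;> simp [jeta, jsig, jmul, emul, omul, eomul] <;> ring

lemma derDeg_jtilde_add_jeta (μ : Derivation F Z Z) (a c : Z) :
    DerDeg ((0, 0) : ZMod 2 × ZMod 2) (jtilde μ a + jeta c) := by
  rw [derDeg_zero_iff]
  intro k u hu j hj
  simp only [jtilde, jeta, Pi.add_apply, Prod.fst_add, Prod.snd_add, hu j hj]
  by_cases h0 : j = 0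
  · subst h0
    simp [hu 0 hj]
  · simp [h0]

/-- The degree-`[0,0]` derivations of `J` are the maps `jtilde μ a + jeta c`. -/
lemma mem_derJSet_and_derDeg_iff (h2 : (2 : F) ≠ 0)
    (hspan : Submodule.span F {z : Z | ∃ f g : Z, z = f * δ g} = ⊤) {d : J Z → J Z} :
    (d ∈ DerJSet F δ ∧ DerDeg ((0, 0) : ZMod 2 × ZMod 2) d) ↔
      ∃ (μ : Derivation F Z Z) (a c : Z), (∀ f, μ (δ f) - δ (μ f) = 2 * a * δ f) ∧
        d = jtilde μ a + jeta c := by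
  constructor
  · rintro ⟨⟨d0, d1, h0, h1, rfl⟩, hdeg⟩
    obtain ⟨w0, x0, w1, x1⟩ := hdeg.components h0 h1
    obtain ⟨μ, a, h, rfl⟩ := h0.eq_jtilde h2 w0 x0
    obtain ⟨c, rfl⟩ := h1.eq_jeta hspan w1 x1
    exact ⟨μ, a, c, h, rfl⟩
  · rintro ⟨μ, a, c, h, rfl⟩
    exact ⟨⟨_, _, isDer0_jtilde h, isDer1_jeta c, rfl⟩, derDeg_jtilde_add_jeta μ a c⟩

/-- The even derivations of `K` are the maps `kcheck μ a`. -/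
lemma isKDer0_iff {e : Z × Z → Z × Z} :
    IsKDer0 F δ e ↔ ∃ (μ : Derivation F Z Z) (a : Z),
      (∀ f, μ (δ f) - δ (μ f) = 2 * a * δ f) ∧ e = kcheck μ a := by
  constructor
  · rintro ⟨⟨hadd, hsmul⟩, he, ho, hder⟩
    generalize hM : (fun f => (e (f, 0)).1) = M
    generalize hN : (fun f => (e (0, f)).2) = N
    have hf (f) : e (f, 0) = (M f, 0) := by rw [← hM]; exact Prod.ext rfl (he _ rfl)
    have hx (f) : e (0, f) = (0, N f) := by rw [← hN]; exact Prod.ext (ho _ rfl) rfl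
    have Mmul (f g) : M (f * g) = M f * g + f * M g := by
      simpa [kmul, hf] using hder (f, 0) (g, 0)
    have Nmul (f) : N f = M f + f * N 1 := by
      simpa [kmul, hf, hx] using hder (f, 0) (0, 1)
    have M1 : M 1 = 0 := by simpa using Mmul 1 1
    let μ : Derivation F Z Z :=
      { toFun := M
        map_add' := fun f g => by simpa [hf] using hadd (f, 0) (g, 0)
        map_smul' := fun c f => by simpa [hf] using hsmul c (f, 0)
        map_one_eq_zero' := M1
        leibniz' := fun f g => by
          simp only [LinearMap.coe_mk, AddHom.coe_mk, smul_eq_mul, Mmul f g]; ring }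
    refine ⟨μ, N 1, fun f => ?_, funext fun u => ?_⟩
    · have h := hder (0, f) (0, 1)
      simp [kmul, hf, hx, Nmul f] at h
      change M (δ f) - δ (M f) = _
      linear_combination h
    · have h := hadd (u.1, 0) (0, u.2)
      rw [hf, hx, Nmul u.2] at h
      simpa [kcheck, μ, mul_comm] using h
  · rintro ⟨μ, a, h, rfl⟩
    have h' (f : Z) : μ (δ f) = δ (μ f) + 2 * a * δ f := by rw [← h]; ring
    refine ⟨⟨fun u v => ?_, fun c u => ?_⟩, fun u hu => ?_, fun u hu => ?_, fun u v => ?_⟩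
    · ext <;> simp [kcheck]
      ring
    · ext <;> simp [kcheck]
    · simp [kcheck, hu]
    · simp [kcheck, hu]
    · ext <;> simp [kcheck, kmul, h'] <;> ring

lemma mem_derbarK_iff {e : Z × Z → Z × Z} :
    e ∈ DerbarK F δ ↔ ∃ (μ : Derivation F Z Z) (a c : Z),
      (∀ f, μ (δ f) - δ (μ f) = 2 * a * δ f) ∧ e = kcheck μ a + keta c := by
  constructor
  · rintro ⟨e0, c, h0, rfl⟩
    obtain ⟨μ, a, h, rfl⟩ := isKDer0_iff.1 h0
    exact ⟨μ, a, c, h, rfl⟩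
  · rintro ⟨μ, a, c, h, rfl⟩
    exact ⟨_, c, isKDer0_iff.2 ⟨μ, a, h, rfl⟩, rfl⟩

end Models

section Coordinatization

variable {F : Type*} [Field F] {Z : Type*} [CommRing Z] [Algebra F Z] {δ : Derivation F Z Z}

lemma algebraMap_sq_eq_neg_one {i : F} (hi : i ^ 2 = -1) : algebraMap F Z i ^ 2 = -1 := by
  rw [← map_pow, hi, map_neg, map_one]

lemma Phi_apply {i : F} (hi : i ^ 2 = -1) (p : Z × Z) (u : J Z) :
    Phi F δ i p u =
      (![algebraMap F Z i * p.2 * u.2 3, -(p.1 * u.1 2) - algebraMap F Z i * p.2 * u.2 2,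
          p.1 * u.1 1 + algebraMap F Z i * p.2 * u.2 1,
          algebraMap F Z i * (δ p.2 * u.2 0 - p.2 * δ (u.2 0))],
        ![algebraMap F Z i * p.2 * u.1 3,
          -(p.1 * u.2 2) - algebraMap F Z i * p.2 * δ (u.1 2),
          p.1 * u.2 1 + algebraMap F Z i * p.2 * δ (u.1 1),
          δ p.1 * u.2 0 - algebraMap F Z i * p.2 * δ (u.1 0)]) := by
  have hI := algebraMap_sq_eq_neg_one (Z := Z) hi
  have hs (f : Z) : i • f = algebraMap F Z i * f := Algebra.smul_def i f
  ext j <;> fin_cases j <;>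
    simp [Phi, Dgen, jmul, emul, omul, eomul, fw, fx, fxi, hs] <;>
    grind

lemma odp_Phi (h2 : (2 : F) ≠ 0) {i : F} (hi : i ^ 2 = -1) (p : Z × Z) :
    odp F (Phi F δ i p) = Phi F δ i (0, p.2) := by
  funext u
  rw [odp, inv_smul_eq_iff₀ h2]
  simp only [Phi_apply hi]
  ext j <;> fin_cases j <;> simp [jsig, two_smul] <;> ring

lemma odp_jtilde_add_jeta (h2 : (2 : F) ≠ 0) (μ : Derivation F Z Z) (a c : Z) :
    odp F (jtilde μ a + jeta c) = jeta c := by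
  funext u
  rw [odp, inv_smul_eq_iff₀ h2]
  ext j <;> fin_cases j <;> simp [jtilde, jeta, jsig, two_smul] <;> ring

/-- The map `∂ ↦ ρ ∘ ∂|_K ∘ ρ⁻¹`, where `ρ(f + gx) = f + i·gx`; on degree-`[0,0]`
derivations it is `Φ*`. -/
def phiStar (i : F) : (J Z → J Z) →ₗ[F] ((Z × Z) → Z × Z) where
  toFun d := fun z =>
    ((d (kap (z.1, -(i • z.2)))).1 0, i • (d (kap (z.1, -(i • z.2)))).2 0)
  map_add' d d' := by ext z <;> simp
  map_smul' c d := funext fun z => Prod.ext rfl (smul_comm i c _)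

lemma phiStar_apply (i : F) (d : J Z → J Z) (z : Z × Z) :
    phiStar i d z =
      ((d (kap (z.1, -(i • z.2)))).1 0, i • (d (kap (z.1, -(i • z.2)))).2 0) := rfl

lemma phiStar_jtilde_add_jeta {i : F} (hi : i ^ 2 = -1) (μ : Derivation F Z Z) (a c : Z) :
    phiStar i (jtilde μ a + jeta c) = kcheck μ a + keta (-(i • c)) := by
  have hI := algebraMap_sq_eq_neg_one (Z := Z) hi
  ext z <;>
    simp [phiStar_apply, kap, jtilde, jeta, kcheck, keta, Algebra.smul_def (A := Z) i]
  · ring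
  · linear_combination (-(a * z.2) - μ z.2) * hI

lemma jtilde_eq (μ : Z → Z) (a : Z) (u : J Z) :
    jtilde μ a u =
      (![μ (u.1 0), μ (u.1 1), μ (u.1 2), μ (u.1 3)],
        ![μ (u.2 0) + a * u.2 0, μ (u.2 1) - a * u.2 1, μ (u.2 2) - a * u.2 2,
          μ (u.2 3) - a * u.2 3]) := by
  ext j <;> fin_cases j <;> simp [jtilde]

lemma jeta_eq (c : Z) (u : J Z) :
    jeta c u =
      (![c * u.2 0, 0, 0, 0], ![0, -(c * u.1 1), -(c * u.1 2), -(c * u.1 3)]) := by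
  ext j <;> fin_cases j <;> simp [jeta]

lemma Phi_phiStar (h2 : (2 : F) ≠ 0) {i : F} (hi : i ^ 2 = -1) {μ : Derivation F Z Z} {a : Z}
    (h : ∀ f, μ (δ f) - δ (μ f) = 2 * a * δ f) (c : Z) (z : Z × Z) :
    Phi F δ i (phiStar i (jtilde μ a + jeta c) z) =
      sbr F (jtilde μ a + jeta c) (Phi F δ i z) := by
  have h' (f : Z) : μ (δ f) = δ (μ f) + 2 * a * δ f := by rw [← h]; ring
  rw [phiStar_jtilde_add_jeta hi]
  funext u
  simp only [sbr, odp_Phi h2 hi, odp_jtilde_add_jeta h2, Pi.add_apply, Pi.sub_apply,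
    Pi.smul_apply, Function.comp_apply, Phi_apply hi, jtilde_eq, jeta_eq]
  ext j <;> fin_cases j <;>
    simp [kcheck, keta, h', two_smul, Algebra.smul_def (A := Z) i] <;> ring

lemma phiStar_injOn {i : F} (hi : i ^ 2 = -1) {μ μ' : Derivation F Z Z} {a a' c c' : Z}
    (h : phiStar i (jtilde μ a + jeta c) = phiStar i (jtilde μ' a' + jeta c')) :
    jtilde μ a + jeta c = jtilde μ' a' + jeta c' := by
  have hi0 : i ≠ 0 := by rintro rfl; simp at hi
  rw [phiStar_jtilde_add_jeta hi, phiStar_jtilde_add_jeta hi] at h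
  have hμ : (μ : Z → Z) = μ' := funext fun f => by
    simpa [kcheck, keta] using congrArg (fun e : Z × Z → Z × Z => (e (f, 0)).1) h
  have ha : a = a' := by
    simpa [kcheck, keta] using congrArg (fun e : Z × Z → Z × Z => (e (0, 1)).2) h
  have hc : c = c' := by
    have := congrArg (fun e : Z × Z → Z × Z => (e (0, 1)).1) h
    simpa [kcheck, keta, hi0] using this
  rw [hμ, ha, hc]

lemma kodp_kcheck_add_keta (h2 : (2 : F) ≠ 0) (μ : Derivation F Z Z) (a c : Z) :
    kodp F (kcheck μ a + keta c) = keta c := by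
  funext u
  rw [kodp, inv_smul_eq_iff₀ h2]
  ext <;> simp [kcheck, keta, ksig, two_smul]
  ring

lemma phiStar_sbr (h2 : (2 : F) ≠ 0) {i : F} (hi : i ^ 2 = -1) (μ μ' : Derivation F Z Z)
    (a a' c c' : Z) :
    phiStar i (sbr F (jtilde μ a + jeta c) (jtilde μ' a' + jeta c')) =
      ksbr F (phiStar i (jtilde μ a + jeta c)) (phiStar i (jtilde μ' a' + jeta c')) := by
  have hI := algebraMap_sq_eq_neg_one (Z := Z) hi
  rw [phiStar_jtilde_add_jeta hi, phiStar_jtilde_add_jeta hi]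
  simp only [ksbr, kodp_kcheck_add_keta h2, sbr, odp_jtilde_add_jeta h2]
  ext z <;>
    simp [phiStar_apply, kap, jtilde, jeta, kcheck, keta, two_smul, Algebra.smul_def (A := Z) i]
  · ring
  · grind

end Coordinatization

end CKJ

namespace CKJ

section Inner

variable {F : Type*} [Field F] {Z : Type*} [CommRing Z] [Algebra F Z] {δ : Derivation F Z Z}

lemma phiStar_Dgen_even_even (i : F) {u v : J Z} (hu : u.2 = 0) (hv : v.2 = 0) :
    phiStar i (Dgen δ 1 u v) = 0 := by
  ext z <;> simp [phiStar_apply, Dgen, jmul, emul, omul, eomul, kap, hu, hv]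
  · ring
  · rw [mul_left_comm, neg_add_cancel]

lemma phiStar_Dgen_odd_odd {i : F} (hi : i ^ 2 = -1) {u v : J Z} (hu : u.1 = 0) (hv : v.1 = 0) :
    phiStar i (Dgen δ (-1) u v) = Dk δ (-1) (0, u.2 0) (0, v.2 0) := by
  have hI := algebraMap_sq_eq_neg_one (Z := Z) hi
  ext z <;>
    simp [phiStar_apply, Dgen, Dk, kmul, jmul, emul, omul, eomul, kap, hu, hv,
      Algebra.smul_def (A := Z) i]
  all_goals grind

lemma phiStar_Dgen_even_odd (i : F) {u v : J Z} (hu : u.2 = 0) (hv : v.1 = 0) :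
    phiStar i (Dgen δ 1 u v) =
      keta (-(i • (v.2 0 * δ (u.1 0) + u.1 1 * v.2 1 + u.1 2 * v.2 2 - u.1 3 * v.2 3))) := by
  ext z <;>
    simp [phiStar_apply, Dgen, keta, jmul, emul, omul, eomul, kap, hu, hv,
      Algebra.smul_def (A := Z) i] <;>
    ring

lemma Dgen_one_swap (u v : J Z) : Dgen δ 1 u v = -Dgen δ 1 v u := by
  funext c
  simp [Dgen]

lemma Dk_one_swap (u v : Z × Z) : Dk δ 1 u v = -Dk δ 1 v u := by
  funext c
  simp [Dk]

lemma Dk_even_even {u v : Z × Z} (hu : u.2 = 0) (hv : v.2 = 0) : Dk δ 1 u v = 0 := by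
  ext z <;> simp [Dk, kmul, hu, hv] <;> ring

lemma Dk_even_odd {u v : Z × Z} (hu : u.2 = 0) (hv : v.1 = 0) :
    Dk δ 1 u v = keta (v.2 * δ u.1) := by
  ext z <;> simp [Dk, keta, kmul, hu, hv] <;> ring

/-- The linear map `a ↦ η_a`. -/
def ketaLin : Z →ₗ[F] (Z × Z → Z × Z) where
  toFun := keta
  map_add' a b := by ext z <;> simp [keta, add_mul]
  map_smul' c a := by ext z <;> simp [keta]

lemma keta_mem_span_inderKSet
    (hspan : Submodule.span F {z : Z | ∃ f g : Z, z = f * δ g} = ⊤) (a : Z) :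
    keta a ∈ Submodule.span F (InderKSet δ) := by
  have h : Submodule.span F {z : Z | ∃ f g : Z, z = f * δ g} ≤
      (Submodule.span F (InderKSet δ)).comap ketaLin := by
    rw [Submodule.span_le]
    rintro _ ⟨f, g, rfl⟩
    refine Submodule.subset_span ⟨(g, 0), (0, f), false, true, rfl, rfl, ?_⟩
    exact (Dk_even_odd (u := (g, 0)) (v := (0, f)) rfl rfl).symm
  rw [hspan] at h
  exact h (Submodule.mem_top (x := a))

lemma phiStar_mem_span_inderKSet
    (hspan : Submodule.span F {z : Z | ∃ f g : Z, z = f * δ g} = ⊤) {i : F} (hi : i ^ 2 = -1)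
    {d : J Z → J Z} (hd : d ∈ Submodule.span F (InderSet δ)) :
    phiStar i d ∈ Submodule.span F (InderKSet δ) := by
  suffices h : Submodule.span F (InderSet δ) ≤
      (Submodule.span F (InderKSet δ)).comap (phiStar i) from h hd
  rw [Submodule.span_le]
  rintro _ ⟨u, v, p, q, hu, hv, rfl⟩
  rw [SetLike.mem_coe, Submodule.mem_comap]
  cases p <;> cases q <;> simp only [IsHom, if_true, Bool.false_eq_true, if_false] at hu hv <;>
    simp only [sgn, Bool.and_true, Bool.and_false, Bool.false_eq_true, if_true, if_false]
  · rw [phiStar_Dgen_even_even i hu hv]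
    exact zero_mem _
  · rw [phiStar_Dgen_even_odd i hu hv]
    exact keta_mem_span_inderKSet hspan _
  · rw [Dgen_one_swap, map_neg, phiStar_Dgen_even_odd i hv hu]
    exact neg_mem (keta_mem_span_inderKSet hspan _)
  · rw [phiStar_Dgen_odd_odd hi hu hv]
    exact Submodule.subset_span ⟨_, _, true, true, by simp [KHom], by simp [KHom], rfl⟩

lemma jmul_kap_sector (p : Z × Z) {k : Fin 4} {u : J Z}
    (hu : ∀ j ≠ k, u.1 j = 0 ∧ u.2 j = 0) :
    ∀ j ≠ k, (jmul δ (kap p) u).1 j = 0 ∧ (jmul δ (kap p) u).2 j = 0 := by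
  intro j hj
  have h := hu j hj
  fin_cases j <;> simp_all [jmul, emul, omul, eomul, kap]

lemma derDeg_Dgen_kap (ε : ℤ) (p q : Z × Z) :
    DerDeg ((0, 0) : ZMod 2 × ZMod 2) (Dgen δ ε (kap p) (kap q)) := by
  rw [derDeg_zero_iff]
  intro k u hu j hj
  have h1 := jmul_kap_sector (δ := δ) p (jmul_kap_sector (δ := δ) q hu) j hj
  have h2 := jmul_kap_sector (δ := δ) q (jmul_kap_sector (δ := δ) p hu) j hj
  simp [Dgen, h1, h2]

/-- `Inder(J)^{[0,0]}` as a subspace of `End_F(J)`. -/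
def inderZero (F : Type*) [Field F] {Z : Type*} [CommRing Z] [Algebra F Z] (δ : Z → Z) :
    Submodule F (J Z → J Z) where
  carrier := {d | d ∈ (Submodule.span F (InderSet δ) : Set (J Z → J Z)) ∧
    DerDeg ((0, 0) : ZMod 2 × ZMod 2) d}
  zero_mem' := ⟨zero_mem _, by simp [derDeg_zero_iff]⟩
  add_mem' := by
    rintro d d' ⟨h, hd⟩ ⟨h', hd'⟩
    refine ⟨add_mem h h', fun s u hu k hk => ?_⟩
    simp [hd s u hu k hk, hd' s u hu k hk]
  smul_mem' := by
    rintro c d ⟨h, hd⟩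
    refine ⟨Submodule.smul_mem _ c h, fun s u hu k hk => ?_⟩
    simp [hd s u hu k hk]

lemma keta_mem_map_phiStar {i : F} (hi : i ^ 2 = -1) (f g : Z) :
    keta (g * δ f) ∈ (inderZero F δ).map (phiStar i) := by
  refine ⟨Dgen δ 1 (kap (i • f, 0)) (kap (0, g)), ⟨Submodule.subset_span
    ⟨_, _, false, true, ?_, ?_, rfl⟩, derDeg_Dgen_kap _ _ _⟩, ?_⟩
  · simp [IsHom, kap]; rfl
  · simp [IsHom, kap]; rfl
  · rw [phiStar_Dgen_even_odd i (by simp [kap]; rfl) (by simp [kap]; rfl)]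
    simp [kap, smul_smul, ← sq, hi]

lemma map_phiStar_inderZero
    (hspan : Submodule.span F {z : Z | ∃ f g : Z, z = f * δ g} = ⊤) {i : F} (hi : i ^ 2 = -1) :
    (inderZero F δ).map (phiStar i) = Submodule.span F (InderKSet δ) := by
  apply le_antisymm
  · rintro _ ⟨d, hd, rfl⟩
    exact phiStar_mem_span_inderKSet hspan hi hd.1
  · rw [Submodule.span_le]
    rintro _ ⟨u, v, p, q, hu, hv, rfl⟩
    rw [SetLike.mem_coe]
    cases p <;> cases q <;> simp only [KHom, if_true, Bool.false_eq_true, if_false] at hu hv <;>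
      simp only [sgn, Bool.and_true, Bool.and_false, Bool.false_eq_true, if_true, if_false]
    · rw [Dk_even_even hu hv]
      exact zero_mem _
    · rw [Dk_even_odd hu hv]
      exact keta_mem_map_phiStar hi _ _
    · rw [Dk_one_swap, Dk_even_odd hv hu]
      exact neg_mem (keta_mem_map_phiStar hi _ _)
    · have hu' : (kap u).1 = 0 := by simp [kap, hu]; rfl
      have hv' : (kap v).1 = 0 := by simp [kap, hv]; rfl
      refine ⟨Dgen δ (-1) (kap u) (kap v), ⟨Submodule.subset_span
        ⟨_, _, true, true, hu', hv', rfl⟩, derDeg_Dgen_kap _ _ _⟩, ?_⟩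
      rw [phiStar_Dgen_odd_odd hi hu' hv', ← hu]
      nth_rewrite 2 [hu]
      rw [← hv]
      simp [kap]

end Inner

end CKJ

open CKJ
theorem stmt18 {F : Type*} [Field F] (h2 : (2 : F) ≠ 0) {Z : Type*} [CommRing Z] [Algebra F Z]
    (δ : Derivation F Z Z)
    (hspan : Submodule.span F {z : Z | ∃ f g : Z, z = f * δ g} = ⊤)
    (i : F) (hi : i ^ 2 = -1) :
    ∃ T : (J Z → J Z) → ((Z × Z) → Z × Z),
      -- T = Φ* : ∂ ↦ (z ↦ Φ⁻¹([∂, Φ(z)])) on Der(J)^{[0,0]}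
      (∀ d ∈ {d : J Z → J Z | d ∈ DerJSet F (⇑δ)
            ∧ DerDeg ((0, 0) : ZMod 2 × ZMod 2) d},
        ∀ z : Z × Z, Phi F (⇑δ) i (T d z) = sbr F d (Phi F (⇑δ) i z)) ∧
      -- Φ* is injective on Der(J)^{[0,0]}
      Set.InjOn T {d : J Z → J Z | d ∈ DerJSet F (⇑δ)
          ∧ DerDeg ((0, 0) : ZMod 2 × ZMod 2) d} ∧
      -- with image D̄er(K) = Der(K)₀ ⊕ {η_a : a ∈ Z}
      (T '' {d : J Z → J Z | d ∈ DerJSet F (⇑δ)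
            ∧ DerDeg ((0, 0) : ZMod 2 × ZMod 2) d} = DerbarK F (⇑δ)) ∧
      -- Φ* is a homomorphism of Lie superalgebras
      (∀ d ∈ {d : J Z → J Z | d ∈ DerJSet F (⇑δ)
            ∧ DerDeg ((0, 0) : ZMod 2 × ZMod 2) d},
       ∀ d' ∈ {d : J Z → J Z | d ∈ DerJSet F (⇑δ)
            ∧ DerDeg ((0, 0) : ZMod 2 × ZMod 2) d},
        T (d + d') = T d + T d') ∧
      (∀ (c : F), ∀ d ∈ {d : J Z → J Z | d ∈ DerJSet F (⇑δ)
            ∧ DerDeg ((0, 0) : ZMod 2 × ZMod 2) d}, T (c • d) = c • T d) ∧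
      (∀ d ∈ {d : J Z → J Z | d ∈ DerJSet F (⇑δ)
            ∧ DerDeg ((0, 0) : ZMod 2 × ZMod 2) d},
       ∀ d' ∈ {d : J Z → J Z | d ∈ DerJSet F (⇑δ)
            ∧ DerDeg ((0, 0) : ZMod 2 × ZMod 2) d},
        T (sbr F d d') = ksbr F (T d) (T d')) ∧
      -- Φ* maps Inder(J)^{[0,0]} onto Inder(K)
      (T '' {d : J Z → J Z |
            d ∈ (Submodule.span F (InderSet (⇑δ)) : Set (J Z → J Z))
              ∧ DerDeg ((0, 0) : ZMod 2 × ZMod 2) d}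
          = (Submodule.span F (InderKSet (⇑δ)) : Set ((Z × Z) → Z × Z))) := by
  refine ⟨phiStar i, ?_, ?_, ?_, fun _ _ _ _ => map_add _ _ _, fun c d _ => map_smul _ c d, ?_,
    congrArg (fun S : Submodule F (Z × Z → Z × Z) => (S : Set (Z × Z → Z × Z)))
      (map_phiStar_inderZero hspan hi)⟩
  · intro d hd z
    obtain ⟨μ, a, c, h, rfl⟩ := (mem_derJSet_and_derDeg_iff h2 hspan).1 hd
    exact Phi_phiStar h2 hi h c z
  · intro d hd d' hd' hdd'
    obtain ⟨μ, a, c, -, rfl⟩ := (mem_derJSet_and_derDeg_iff h2 hspan).1 hd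
    obtain ⟨μ', a', c', -, rfl⟩ := (mem_derJSet_and_derDeg_iff h2 hspan).1 hd'
    exact phiStar_injOn hi hdd'
  · ext e
    rw [mem_derbarK_iff]
    constructor
    · rintro ⟨d, hd, rfl⟩
      obtain ⟨μ, a, c, h, rfl⟩ := (mem_derJSet_and_derDeg_iff h2 hspan).1 hd
      exact ⟨μ, a, _, h, phiStar_jtilde_add_jeta hi μ a c⟩
    · rintro ⟨μ, a, c, h, rfl⟩
      refine ⟨jtilde μ a + jeta (i • c),
        (mem_derJSet_and_derDeg_iff h2 hspan).2 ⟨μ, a, _, h, rfl⟩, ?_⟩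
      rw [phiStar_jtilde_add_jeta hi, smul_smul, ← sq, hi, neg_one_smul, neg_neg]
  · intro d hd d' hd'
    obtain ⟨μ, a, c, -, rfl⟩ := (mem_derJSet_and_derDeg_iff h2 hspan).1 hd
    obtain ⟨μ', a', c', -, rfl⟩ := (mem_derJSet_and_derDeg_iff h2 hspan).1 hd'
    exact phiStar_sbr h2 hi μ μ' a a' c c'
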